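/- arXiv:2507.19614 — 5 statements merged into one kernel-verified Lean document; each statement's English description precedes it below -/
import Mathlib

section
/- Let r, s ∈ ℕ with r, s ≥ 2. Let G be the free group on r+s generators and let H ≤ G be the subgroup generated by the first r generators, and let X = G/H be the (countably infinite, discrete) left coset space with the left translation action of G. Then the induced action of G on the Stone–Čech boundary ∂_βX is topologically amenable: for every ε > 0 and every finite subset F ⊆ G there exists a continuous map m : ∂_βX → ℓ¹(G) such that for every z ∈ ∂_βX, m z is nonnegative with ∑_{g∈G} (m z)(g) = 1, and for all g ∈ F and all z ∈ ∂_βX one has ‖m(g•z) − g·(m z)‖₁ ≤ ε, where (g·φ)(h) = φ(g⁻¹h). -/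
noncomputable section

/-- The free group on `r + s` generators. -/
abbrev FG (r s : ℕ) : Type := FreeGroup (Fin (r + s))

/-- The subgroup of `F_{r+s}` generated by the first `r` generators (a copy of `F_r`). -/
def firstFactor (r s : ℕ) : Subgroup (FG r s) :=
  Subgroup.closure (Set.range fun i : Fin r => FreeGroup.of (Fin.castAdd s i))

/-- The coset space `F_{r+s} / F_r`, with the left translation action of `F_{r+s}`. -/
abbrev Coset (r s : ℕ) : Type := FG r s ⧸ firstFactor r s

instance (r s : ℕ) : TopologicalSpace (Coset r s) := ⊥

instance (r s : ℕ) : DiscreteTopology (Coset r s) := ⟨rfl⟩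

/-- Letters of the first factor. -/
def isFst (r s : ℕ) (p : Fin (r + s) × Bool) : Bool := decide (p.1.val < r)

/-- Reduced word with the trailing letters of the first factor removed. -/
def stripWord (r s : ℕ) (g : FG r s) : List (Fin (r + s) × Bool) :=
  g.toWord.rdropWhile (isFst r s)

lemma stripWord_mul_of (r s : ℕ) (g : FG r s) (i : Fin r) :
    stripWord r s (g * FreeGroup.of (Fin.castAdd s i)) = stripWord r s g := by
  have hp : ∀ b, isFst r s (Fin.castAdd s i, b) = true := by
    intro b; simp [isFst]
  unfold stripWord
  rw [FreeGroup.toWord_mul, FreeGroup.toWord_of]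
  have hred : FreeGroup.IsReduced g.toWord := FreeGroup.isReduced_toWord
  rcases List.eq_nil_or_concat g.toWord with h | ⟨L, b, h⟩
  · rw [h]
    rw [List.nil_append, FreeGroup.reduce_singleton, List.rdropWhile_singleton, hp]
    simp
  · rw [List.concat_eq_append] at h
    rw [h] at hred ⊢
    by_cases hb : b = (Fin.castAdd s i, false)
    · subst hb
      have h1 : FreeGroup.reduce (L ++ [(Fin.castAdd s i, false)] ++ [(Fin.castAdd s i, true)])
          = FreeGroup.reduce L := by
        apply FreeGroup.reduce.Step.eq
        have := @FreeGroup.Red.Step.not _ L [] (Fin.castAdd s i) false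
        simpa using this
      have h2 : FreeGroup.reduce L = L :=
        (hred.infix ⟨[], [(Fin.castAdd s i, false)], by simp⟩).reduce_eq
      rw [h1, h2, List.rdropWhile_concat_pos _ _ _ (hp _)]
    · have h1 : FreeGroup.IsReduced (L ++ [b] ++ [(Fin.castAdd s i, true)]) := by
        apply FreeGroup.IsReduced.append_overlap hred _ (by simp)
        rw [List.singleton_append, FreeGroup.isReduced_cons_cons]
        refine ⟨?_, FreeGroup.IsReduced.singleton⟩
        intro hb1
        rcases b with ⟨b1, b2⟩
        simp only at hb1
        subst hb1
        cases b2 <;> simp_all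
      rw [h1.reduce_eq, List.rdropWhile_concat_pos _ _ _ (hp _)]

lemma stripWord_mul (r s : ℕ) (h : FG r s) (hh : h ∈ firstFactor r s) :
    ∀ g : FG r s, stripWord r s (g * h) = stripWord r s g := by
  unfold firstFactor at hh
  induction hh using Subgroup.closure_induction with
  | mem x hx =>
    obtain ⟨i, rfl⟩ := hx
    intro g
    exact stripWord_mul_of r s g i
  | one => simp
  | mul x y _ _ hx hy =>
    intro g
    rw [← mul_assoc, hy, hx]
  | inv x _ hx =>
    intro g
    have := hx (g * x⁻¹)
    simpa using this.symm

/-- Word of a coset. -/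
def cosetWord (r s : ℕ) : Coset r s → List (Fin (r + s) × Bool) :=
  Quotient.lift (stripWord r s) (by
    intro a b hab
    have h : a⁻¹ * b ∈ firstFactor r s := QuotientGroup.leftRel_apply.mp hab
    have := stripWord_mul r s _ h a
    simpa using this.symm)

lemma cosetWord_mk (r s : ℕ) (g : FG r s) :
    cosetWord r s (QuotientGroup.mk g) = stripWord r s g := rfl

lemma mk_mem_firstFactor (r s : ℕ) (L : List (Fin (r + s) × Bool))
    (hL : ∀ x ∈ L, isFst r s x = true) : FreeGroup.mk L ∈ firstFactor r s := by
  induction L with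
  | nil => exact (firstFactor r s).one_mem
  | cons x L ih =>
    have h1 : FreeGroup.mk (x :: L) = FreeGroup.mk [x] * FreeGroup.mk L := by
      simp
    rw [h1]
    apply (firstFactor r s).mul_mem _ (ih fun y hy => hL y (List.mem_cons_of_mem _ hy))
    have hx := hL x List.mem_cons_self
    rcases x with ⟨x, b⟩
    have hx' : x.val < r := by simpa [isFst] using hx
    have hof : FreeGroup.of x ∈ firstFactor r s := by
      apply Subgroup.subset_closure
      exact ⟨⟨x.val, hx'⟩, by congr 1⟩
    cases b
    · have : (FreeGroup.mk [(x, false)] : FG r s) = (FreeGroup.of x)⁻¹ := by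
        simp [FreeGroup.of, FreeGroup.invRev]
      rw [this]
      exact (firstFactor r s).inv_mem hof
    · exact hof

lemma mk_cosetWord (r s : ℕ) (x : Coset r s) :
    (QuotientGroup.mk (FreeGroup.mk (cosetWord r s x)) : Coset r s) = x := by
  induction x using QuotientGroup.induction_on with
  | H g =>
    rw [cosetWord_mk]
    rw [QuotientGroup.eq]
    have h1 : FreeGroup.mk (stripWord r s g) *
        FreeGroup.mk (g.toWord.rtakeWhile (isFst r s)) = g := by
      rw [FreeGroup.mul_mk]
      unfold stripWord
      rw [List.rdropWhile_append_rtakeWhile, FreeGroup.mk_toWord]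
    have h2 : (FreeGroup.mk (stripWord r s g))⁻¹ * g =
        FreeGroup.mk (g.toWord.rtakeWhile (isFst r s)) := by
      rw [inv_mul_eq_iff_eq_mul, h1]
    rw [h2]
    exact mk_mem_firstFactor r s _ fun x hx => List.mem_rtakeWhile_imp hx

lemma finite_short (r s N : ℕ) : {x : Coset r s | (cosetWord r s x).length ≤ N}.Finite := by
  have hf : {l : List (Fin (r + s) × Bool) | l.length ≤ N}.Finite := List.finite_length_le _ N
  apply Set.Finite.of_finite_image (f := cosetWord r s)
  · exact hf.subset (by rintro _ ⟨x, hx, rfl⟩; exact hx)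
  · intro x _ y _ hxy
    rw [← mk_cosetWord r s x, ← mk_cosetWord r s y, hxy]

lemma rdropWhile_cons' {α : Type*} (p : α → Bool) (c : α) (L : List α)
    (h : L.rdropWhile p ≠ []) : (c :: L).rdropWhile p = c :: L.rdropWhile p := by
  induction L using List.reverseRecOn with
  | nil => simp at h
  | append_singleton L b ih =>
    rw [← List.cons_append]
    by_cases hb : p b
    · rw [List.rdropWhile_concat_pos _ _ _ hb] at h ⊢
      rw [List.rdropWhile_concat_pos _ _ _ hb, ih h]
    · rw [List.rdropWhile_concat_neg _ _ _ hb, List.rdropWhile_concat_neg _ _ _ hb]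
      rfl

lemma rdropWhile_cons_nil {α : Type*} (p : α → Bool) (c : α) (L : List α)
    (h : L.rdropWhile p = []) : ((c :: L).rdropWhile p).length ≤ 1 := by
  induction L using List.reverseRecOn with
  | nil => exact (List.rdropWhile_prefix p _).length_le
  | append_singleton L b ih =>
    rw [← List.cons_append]
    by_cases hb : p b
    · rw [List.rdropWhile_concat_pos _ _ _ hb] at h ⊢
      exact ih h
    · rw [List.rdropWhile_concat_neg _ _ _ hb] at h
      simp at h

lemma cosetWord_of_smul (r s : ℕ) (a : Fin (r + s)) (x : Coset r s)
    (hx : 2 ≤ (cosetWord r s x).length) :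
    cosetWord r s ((FreeGroup.of a : FG r s) • x) = (a, true) :: cosetWord r s x ∨
    cosetWord r s x = (a, false) :: cosetWord r s ((FreeGroup.of a : FG r s) • x) := by
  induction x using QuotientGroup.induction_on with
  | H g =>
    have h0 : (FreeGroup.of a : FG r s) • (QuotientGroup.mk g : Coset r s) =
      QuotientGroup.mk (FreeGroup.of a * g) := rfl
    rw [h0, cosetWord_mk, cosetWord_mk]
    rw [cosetWord_mk] at hx
    unfold stripWord at hx ⊢
    have hw : (FreeGroup.of a * g).toWord = FreeGroup.reduce ((a, true) :: g.toWord) := by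
      rw [FreeGroup.toWord_mul, FreeGroup.toWord_of]; rfl
    rw [hw, FreeGroup.reduce.cons, FreeGroup.reduce_toWord]
    rcases hg : g.toWord with _ | ⟨c, t⟩
    · rw [hg] at hx; simp at hx
    · rw [hg] at hx
      by_cases hc : a = c.1 ∧ true = !c.2
      · right
        have hc' : c = (a, false) := by
          obtain ⟨h1, h2⟩ := hc
          refine Prod.ext h1.symm ?_
          revert h2
          cases c.2 <;> simp
        simp only [if_pos hc]
        rw [rdropWhile_cons', ← hc']
        · intro hnil
          have := rdropWhile_cons_nil (isFst r s) c t hnil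
          omega
      · left
        simp only [if_neg hc]
        rw [rdropWhile_cons']
        intro hnil
        rw [hnil] at hx
        simp at hx

/-- The averaged measure on prefixes. -/
def mu (r s N : ℕ) (l : List (Fin (r + s) × Bool)) : lp (fun _ : FG r s => ℝ) 1 :=
  (N : ℝ)⁻¹ • ∑ k ∈ Finset.range N, lp.single 1 (FreeGroup.mk (l.take k) : FG r s) (1 : ℝ)

lemma mu_apply (r s N : ℕ) (l : List (Fin (r + s) × Bool)) (h : FG r s) :
    mu r s N l h = (N : ℝ)⁻¹ * ∑ k ∈ Finset.range N,
      (Pi.single (FreeGroup.mk (l.take k) : FG r s) (1 : ℝ) : FG r s → ℝ) h := by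
  unfold mu
  rw [lp.coeFn_smul, Pi.smul_apply, lp.coeFn_sum, Finset.sum_apply, smul_eq_mul]
  rfl

lemma mu_take (r s N : ℕ) (l : List (Fin (r + s) × Bool)) :
    mu r s N (l.take N) = mu r s N l := by
  unfold mu
  congr 1
  apply Finset.sum_congr rfl
  intro k hk
  rw [List.take_take, min_eq_left (Finset.mem_range.mp hk).le]

lemma mu_nonneg (r s N : ℕ) (l : List (Fin (r + s) × Bool)) (h : FG r s) :
    0 ≤ mu r s N l h := by
  rw [mu_apply]
  apply mul_nonneg (by positivity)
  apply Finset.sum_nonneg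
  intro k _
  by_cases hk : h = FreeGroup.mk (l.take k)
  · subst hk; simp
  · simp [Pi.single_eq_of_ne hk]

lemma mu_hasSum (r s N : ℕ) (hN : 0 < N) (l : List (Fin (r + s) × Bool)) :
    HasSum (fun h => mu r s N l h) 1 := by
  have h1 : HasSum (fun h : FG r s => ∑ k ∈ Finset.range N,
      (Pi.single (FreeGroup.mk (l.take k) : FG r s) (1 : ℝ) : FG r s → ℝ) h)
      (∑ k ∈ Finset.range N, (1 : ℝ)) := by
    apply hasSum_sum
    intro k _
    exact hasSum_pi_single _ _
  have h2 := h1.mul_left (N : ℝ)⁻¹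
  have hN' : (N : ℝ) ≠ 0 := by positivity
  simp only [← mu_apply] at h2
  simpa [hN'] using h2

/-- Defect of equivariance. -/
def defect {G : Type*} [Group G] (g : G) (f f' : G → ℝ) : ℝ := ∑' h : G, |f' h - f (g⁻¹ * h)|

lemma summable_translate {G : Type*} [Group G] (g : G) {f : G → ℝ} (hf : Summable f) :
    Summable fun h => f (g * h) :=
  (Equiv.mulLeft g).summable_iff.mpr hf

lemma defect_inv {G : Type*} [Group G] (g : G) (f f' : G → ℝ) :
    defect g⁻¹ f' f = defect g f f' := by
  unfold defect
  rw [← (Equiv.mulLeft g⁻¹).tsum_eq]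
  apply tsum_congr
  intro h
  rw [abs_sub_comm]
  simp

lemma defect_mul {G : Type*} [Group G] (g₁ g₂ : G) {f f' f'' : G → ℝ} (hf : Summable f)
    (hf' : Summable f') (hf'' : Summable f'') :
    defect (g₁ * g₂) f f'' ≤ defect g₂ f f' + defect g₁ f' f'' := by
  have h1 : defect g₂ f f' = ∑' h : G, |f' (g₁⁻¹ * h) - f (g₂⁻¹ * (g₁⁻¹ * h))| := by
    unfold defect
    rw [← (Equiv.mulLeft g₁⁻¹).tsum_eq]
    rfl
  have s1 : Summable fun h => |f' (g₁⁻¹ * h) - f (g₂⁻¹ * (g₁⁻¹ * h))| :=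
    ((summable_translate _ hf').sub
      (summable_translate g₁⁻¹ (summable_translate g₂⁻¹ hf))).abs
  have s2 : Summable fun h => |f'' h - f' (g₁⁻¹ * h)| :=
    (hf''.sub (summable_translate _ hf')).abs
  have s3 : Summable fun h => |f'' h - f ((g₁ * g₂)⁻¹ * h)| :=
    (hf''.sub (summable_translate _ hf)).abs
  rw [h1]
  unfold defect
  rw [← s1.tsum_add s2]
  apply s3.tsum_le_tsum _ (s1.add s2)
  intro h
  rw [mul_inv_rev, mul_assoc, add_comm]
  exact abs_sub_le _ _ _

lemma defect_mu_cons (r s N : ℕ) (hN : 0 < N) (c : Fin (r + s) × Bool)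
    (l : List (Fin (r + s) × Bool)) :
    defect (FreeGroup.mk [c] : FG r s) (mu r s N l) (mu r s N (c :: l)) ≤ 2 / N := by
  obtain ⟨n, rfl⟩ : ∃ n, N = n + 1 := ⟨N - 1, by omega⟩
  set g : FG r s := FreeGroup.mk [c] with hg
  have key : ∀ h : FG r s, mu r s (n + 1) (c :: l) h - mu r s (n + 1) l (g⁻¹ * h) =
      ((n + 1 : ℕ) : ℝ)⁻¹ * ((Pi.single (1 : FG r s) (1 : ℝ) : FG r s → ℝ) h -
        (Pi.single (g * FreeGroup.mk (l.take n)) (1 : ℝ) : FG r s → ℝ) h) := by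
    intro h
    have ht : ∀ k, (Pi.single (FreeGroup.mk (l.take k)) (1 : ℝ) : FG r s → ℝ) (g⁻¹ * h) =
        (Pi.single (g * FreeGroup.mk (l.take k)) (1 : ℝ) : FG r s → ℝ) h := by
      intro k
      simp only [Pi.single_apply, inv_mul_eq_iff_eq_mul]
    have hc : ∀ k, (FreeGroup.mk ((c :: l).take (k + 1)) : FG r s) =
        g * FreeGroup.mk (l.take k) := by
      intro k
      rw [hg, FreeGroup.mul_mk]; rfl
    rw [mu_apply, mu_apply, Finset.sum_range_succ', Finset.sum_range_succ, ← mul_sub]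
    simp only [ht, hc]
    congr 1
    have h1 : (FreeGroup.mk ((c :: l).take 0) : FG r s) = 1 := rfl
    rw [h1]
    ring
  unfold defect
  have hA : HasSum (fun h : FG r s => ((n + 1 : ℕ) : ℝ)⁻¹ *
      ((Pi.single (1 : FG r s) (1 : ℝ) : FG r s → ℝ) h +
        (Pi.single (g * FreeGroup.mk (l.take n)) (1 : ℝ) : FG r s → ℝ) h))
      (((n + 1 : ℕ) : ℝ)⁻¹ * (1 + 1)) :=
    ((hasSum_pi_single _ _).add (hasSum_pi_single _ _)).mul_left _
  have hs : Summable fun h => |mu r s (n + 1) (c :: l) h - mu r s (n + 1) l (g⁻¹ * h)| :=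
    ((mu_hasSum r s _ hN _).summable.sub
      (summable_translate _ (mu_hasSum r s _ hN _).summable)).abs
  have hle := hs.tsum_le_tsum (g := fun h : FG r s => ((n + 1 : ℕ) : ℝ)⁻¹ *
      ((Pi.single (1 : FG r s) (1 : ℝ) : FG r s → ℝ) h +
        (Pi.single (g * FreeGroup.mk (l.take n)) (1 : ℝ) : FG r s → ℝ) h)) (by
    intro h
    rw [key, abs_mul, abs_of_nonneg (by positivity : (0 : ℝ) ≤ ((n + 1 : ℕ) : ℝ)⁻¹)]
    apply mul_le_mul_of_nonneg_left _ (by positivity)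
    have hnn : ∀ a : FG r s, 0 ≤ (Pi.single a (1 : ℝ) : FG r s → ℝ) h := by
      intro a
      rw [Pi.single_apply]
      split_ifs <;> norm_num
    rw [abs_le]
    constructor <;> linarith [hnn 1, hnn (g * FreeGroup.mk (l.take n))]) hA.summable
  rw [hA.tsum_eq] at hle
  refine hle.trans (le_of_eq ?_)
  rw [div_eq_inv_mul]
  norm_num

lemma defect_bound (r s : ℕ) (g : FG r s) : ∃ C : ℝ, ∀ N : ℕ, 0 < N →
    ∃ S : Set (Coset r s), S.Finite ∧ ∀ x ∉ S,
      defect g (mu r s N (cosetWord r s x)) (mu r s N (cosetWord r s (g • x))) ≤ C / N := by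
  have hinv : ∀ g : FG r s, (∃ C : ℝ, ∀ N : ℕ, 0 < N →
    ∃ S : Set (Coset r s), S.Finite ∧ ∀ x ∉ S,
      defect g (mu r s N (cosetWord r s x)) (mu r s N (cosetWord r s (g • x))) ≤ C / N) →
      (∃ C : ℝ, ∀ N : ℕ, 0 < N →
    ∃ S : Set (Coset r s), S.Finite ∧ ∀ x ∉ S,
      defect g⁻¹ (mu r s N (cosetWord r s x)) (mu r s N (cosetWord r s (g⁻¹ • x))) ≤ C / N) := by
    rintro g ⟨C, hC⟩
    refine ⟨C, fun N hN => ?_⟩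
    obtain ⟨S, hS, h⟩ := hC N hN
    refine ⟨(fun x => g • x) '' S, hS.image _, fun x hx => ?_⟩
    have h1 := h (g⁻¹ • x) (fun hm => hx ⟨_, hm, by simp⟩)
    rw [smul_inv_smul] at h1
    rw [defect_inv]
    exact h1
  induction g using FreeGroup.induction_on with
  | C1 =>
    refine ⟨0, fun N _ => ⟨∅, Set.finite_empty, fun x _ => ?_⟩⟩
    simp [defect]
  | of a =>
    refine ⟨2, fun N hN => ⟨_, finite_short r s 1, fun x hx => ?_⟩⟩
    have hx' : 2 ≤ (cosetWord r s x).length := by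
      by_contra hlt
      exact hx (show (cosetWord r s x).length ≤ 1 by omega)
    rcases cosetWord_of_smul r s a x hx' with h | h
    · have := defect_mu_cons r s N hN (a, true) (cosetWord r s x)
      rw [h]
      exact this
    · have := defect_mu_cons r s N hN (a, false)
        (cosetWord r s ((FreeGroup.of a : FG r s) • x))
      rw [← h] at this
      have hi : (FreeGroup.mk [(a, false)] : FG r s) = (FreeGroup.of a)⁻¹ := by
        simp [FreeGroup.of, FreeGroup.invRev]
      rw [hi, defect_inv] at this
      exact this
  | inv_of a h => exact hinv _ h
  | mul x y hx hy =>
    obtain ⟨C₁, h₁⟩ := hx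
    obtain ⟨C₂, h₂⟩ := hy
    refine ⟨C₂ + C₁, fun N hN => ?_⟩
    obtain ⟨S₁, hS₁, h₁⟩ := h₁ N hN
    obtain ⟨S₂, hS₂, h₂⟩ := h₂ N hN
    refine ⟨S₂ ∪ (fun z => y⁻¹ • z) '' S₁, hS₂.union (hS₁.image _), fun z hz => ?_⟩
    have hz2 : z ∉ S₂ := fun hm => hz (Or.inl hm)
    have hz1 : y • z ∉ S₁ := fun hm => hz (Or.inr ⟨_, hm, by simp⟩)
    rw [add_div, mul_smul]
    exact (defect_mul x y (mu_hasSum r s N hN _).summable (mu_hasSum r s N hN _).summable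
      (mu_hasSum r s N hN _).summable).trans (add_le_add (h₂ z hz2) (h₁ _ hz1))

/-- A clopen property of Stone–Čech points holding cofinitely holds on the boundary. -/
lemma boundary_of_cofinite {X : Type*} [TopologicalSpace X] (U : Set (StoneCech X))
    (hU : IsOpen U) (S : Set X) (hS : S.Finite) (hUS : ∀ x, stoneCechUnit x ∈ U → x ∈ S)
    (z : StoneCech X) (hz : z ∉ Set.range (stoneCechUnit : X → StoneCech X)) : z ∉ U := by
  intro hzU
  have hfin : ((stoneCechUnit : X → StoneCech X) '' S).Finite := hS.image _
  have hopen : IsOpen (U ∩ ((stoneCechUnit : X → StoneCech X) '' S)ᶜ) :=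
    hU.inter hfin.isClosed.isOpen_compl
  have hne : (U ∩ ((stoneCechUnit : X → StoneCech X) '' S)ᶜ).Nonempty :=
    ⟨z, hzU, fun ⟨x, _, hx⟩ => hz ⟨x, hx⟩⟩
  obtain ⟨x, hx1, hx2⟩ := denseRange_stoneCechUnit.exists_mem_open hopen hne
  exact hx2 ⟨x, hUS x hx1, rfl⟩

/-- For `r, s ≥ 2`, the action of `F_{r+s}` on the Stone–Čech boundary
`∂_β (F_{r+s} / F_r)` (the complement of the image of the coset space in its Stone–Čech
compactification, with the unique continuous extension of the left translation action) is
topologically amenable: for every `ε > 0` and every finite `F ⊆ F_{r+s}` there is a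
continuous map `m` from the boundary to the space of probability densities in
`ℓ¹(F_{r+s})` which is `(F, ε)`-equivariant in sup norm. -/
theorem stmt_0 (r s : ℕ) (hr : 2 ≤ r) (hs : 2 ≤ s)
    [MulAction (FG r s) (StoneCech (Coset r s))]
    (hcont : ∀ g : FG r s, Continuous fun z : StoneCech (Coset r s) => g • z)
    (hequiv : ∀ (g : FG r s) (x : Coset r s),
      g • stoneCechUnit x = stoneCechUnit (g • x))
    (B : Set (StoneCech (Coset r s)))
    (hB : B = (Set.range (stoneCechUnit : Coset r s → StoneCech (Coset r s)))ᶜ)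
    (hBinv : ∀ (g : FG r s), ∀ z ∈ B, g • z ∈ B)
    (ε : ℝ) (hε : 0 < ε) (F : Finset (FG r s)) :
    ∃ m : B → lp (fun _ : FG r s => ℝ) 1,
      Continuous m ∧
      (∀ (z : B) (g : FG r s), 0 ≤ m z g) ∧
      (∀ z : B, ∑' g : FG r s, m z g = 1) ∧
      ∀ g ∈ F, ∀ z : B,
        ∑' h : FG r s,
          |m ⟨g • (z : StoneCech (Coset r s)), hBinv g z z.2⟩ h - m z (g⁻¹ * h)| ≤ ε := by
  choose C hC using defect_bound r s
  obtain ⟨N, hN, hNC⟩ : ∃ N : ℕ, 0 < N ∧ ∀ g ∈ F, C g / N ≤ ε := by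
    have h1 : ∀ g ∈ F, ∀ᶠ N : ℕ in Filter.atTop, C g / N ≤ ε := fun g _ =>
      (tendsto_const_div_atTop_nhds_zero_nat (C g)).eventually_le_const hε
    have h2 := (Filter.eventually_all_finset F).mpr h1
    obtain ⟨N, hN⟩ := (h2.and (Filter.eventually_gt_atTop 0)).exists
    exact ⟨N, hN.2, hN.1⟩
  let T := {l : List (Fin (r + s) × Bool) // l.length ≤ N}
  have : Finite T := (List.finite_length_le (Fin (r + s) × Bool) N).to_subtype
  let _ : TopologicalSpace T := ⊥
  have : DiscreteTopology T := ⟨rfl⟩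
  let P : Coset r s → T := fun x => ⟨(cosetWord r s x).take N, by simp⟩
  have hP : Continuous P := continuous_of_discreteTopology
  let Q : StoneCech (Coset r s) → T := stoneCechExtend hP
  have hQ : Continuous Q := continuous_stoneCechExtend hP
  have hQu : ∀ x, Q (stoneCechUnit x) = P x := stoneCechExtend_stoneCechUnit hP
  have hμP : ∀ x, mu r s N (P x).1 = mu r s N (cosetWord r s x) := fun x => mu_take r s N _
  refine ⟨fun z => mu r s N (Q z.1).1, ?_, fun z g => mu_nonneg r s N _ g,
    fun z => (mu_hasSum r s N hN _).tsum_eq, fun g hg z => ?_⟩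
  · have h1 : Continuous fun t : T => mu r s N t.1 := continuous_of_discreteTopology
    exact h1.comp (hQ.comp continuous_subtype_val)
  · obtain ⟨S, hS, hSb⟩ := hC g N hN
    let U : Set (StoneCech (Coset r s)) := (fun z => (Q z, Q (g • z))) ⁻¹'
      {p : T × T | ¬ defect g (mu r s N p.1.1) (mu r s N p.2.1) ≤ ε}
    have hU : IsOpen U := (isOpen_discrete _).preimage (hQ.prodMk (hQ.comp (hcont g)))
    have hz : (z : StoneCech (Coset r s)) ∉
        Set.range (stoneCechUnit : Coset r s → StoneCech (Coset r s)) := by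
      have h3 : ∀ y ∈ B, y ∉ Set.range
          (stoneCechUnit : Coset r s → StoneCech (Coset r s)) := by
        intro y hy
        rw [hB] at hy
        exact hy
      exact h3 _ z.2
    have := boundary_of_cofinite U hU S hS (by
      intro x hx
      by_contra hxS
      apply hx
      simp only [hequiv, hQu, hμP]
      exact (hSb x hxS).trans (hNC g hg)) z hz
    exact not_not.mp this

end
end

section
/- Let Γ and Λ be groups, let G = Γ ∗ Λ be their free product, and let K ≤ G be the image of Γ under the canonical inclusion. Consider the left translation action of G on the coset space G/K. Then for any two distinct cosets c ≠ c' in G/K, the intersection of their stabilizers Stab_G(c) ∩ Stab_G(c') is the trivial subgroup; equivalently, for η, η' ∈ G with ηK ≠ η'K one has ηKη⁻¹ ∩ η'K(η')⁻¹ = {1}. -/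
open Monoid in
theorem word_mul_of {ι : Type*} {M : ι → Type*} [∀ i, Group (M i)] (i : ι)
    (w : CoprodI.Word M) :
    w.prod ∈ (CoprodI.of : M i →* CoprodI M).range ∨
      ∀ a : M i, ∃ w' : CoprodI.Word M,
        w'.prod = w.prod * CoprodI.of a ∧ w'.fstIdx = w.fstIdx := by
  classical
  have emp_ne : ∀ j : ι, (CoprodI.Word.empty : CoprodI.Word M).fstIdx ≠ some j := by
    intro j
    simp [CoprodI.Word.fstIdx, CoprodI.Word.empty]
  induction w using CoprodI.Word.consRecOn with
  | empty => left; exact ⟨1, by simp⟩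
  | cons j m w h1 h2 ih =>
    rcases ih with ⟨c, hc⟩ | ih
    · by_cases hij : j = i
      · subst hij
        left
        exact ⟨m * c, by rw [CoprodI.Word.prod_cons, map_mul, hc]⟩
      · right
        intro a
        by_cases hca : c * a = 1
        · refine ⟨CoprodI.Word.cons m CoprodI.Word.empty (emp_ne _) h2, ?_, ?_⟩
          · rw [CoprodI.Word.prod_cons, CoprodI.Word.prod_cons, ← hc, mul_assoc, ← map_mul, hca]
            simp
          · simp
        · refine ⟨CoprodI.Word.cons m (CoprodI.Word.cons (c * a) CoprodI.Word.empty
            (emp_ne _) hca) ?_ h2, ?_, ?_⟩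
          · rw [CoprodI.Word.fstIdx_cons]
            intro h
            exact hij (Option.some.inj h).symm
          · rw [CoprodI.Word.prod_cons, CoprodI.Word.prod_cons, CoprodI.Word.prod_cons, ← hc,
              mul_assoc, ← map_mul]
            simp
          · simp
    · right
      intro a
      obtain ⟨w', hw, hf⟩ := ih a
      refine ⟨CoprodI.Word.cons m w' (by rw [hf]; exact h1) h2, ?_, ?_⟩
      · rw [CoprodI.Word.prod_cons, CoprodI.Word.prod_cons, hw, mul_assoc]
      · simp

open Monoid in
theorem coprodI_malnormal {ι : Type*} {M : ι → Type*} [∀ i, Group (M i)] (i : ι)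
    (x : CoprodI M) (a b : M i) (ha : a ≠ 1)
    (h : x * CoprodI.of a = CoprodI.of b * x) :
    x ∈ (CoprodI.of : M i →* CoprodI M).range := by
  classical
  have hinj : Function.Injective (CoprodI.Word.prod : CoprodI.Word M → CoprodI M) :=
    (CoprodI.Word.equiv (M := M)).symm.injective
  have hb : b ≠ 1 := by
    rintro rfl
    apply ha
    apply CoprodI.of_injective (M := M) i
    simpa using h
  obtain ⟨w, rfl⟩ := (CoprodI.Word.equiv (M := M)).symm.surjective x
  change w.prod * _ = _ * w.prod at h
  change w.prod ∈ _
  obtain ⟨p, rfl⟩ := (CoprodI.Word.equivPair (M := M) i).symm.surjective w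
  rw [CoprodI.Word.equivPair_symm, CoprodI.Word.prod_rcons] at h ⊢
  rcases word_mul_of i p.tail with ht | ht
  · exact mul_mem ⟨_, rfl⟩ ht
  · exfalso
    obtain ⟨w', hw, hf⟩ := ht a
    have hne : p.head⁻¹ * b * p.head ≠ 1 := by
      intro h1
      apply hb
      simpa using (conj_eq_one_iff (a := p.head⁻¹) (b := b)).1 (by simpa using h1)
    have key : w' = CoprodI.Word.cons _ p.tail p.fstIdx_ne hne := by
      apply hinj
      rw [CoprodI.Word.prod_cons, hw, map_mul, map_mul, map_inv]
      rw [mul_assoc, mul_assoc, ← h]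
      group
    apply p.fstIdx_ne
    rw [← hf, key, CoprodI.Word.fstIdx_cons]

universe u v

/-- The two factors, lifted to a common universe. -/
def FactorFam (Γ : Type u) (Λ : Type v) : Bool → Type (max u v)
  | true => ULift.{v} Γ
  | false => ULift.{u} Λ

instance factorFamGroup (Γ : Type u) (Λ : Type v) [Group Γ] [Group Λ] :
    ∀ b, Group (FactorFam Γ Λ b)
  | true => inferInstanceAs (Group (ULift.{v} Γ))
  | false => inferInstanceAs (Group (ULift.{u} Λ))

open Monoid in
theorem coprod_malnormal (Γ : Type u) (Λ : Type v) [Group Γ] [Group Λ]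
    (x : Coprod Γ Λ) (a b : Γ) (ha : a ≠ 1)
    (h : x * Coprod.inl a = Coprod.inl b * x) :
    x ∈ (Coprod.inl : Γ →* Coprod Γ Λ).range := by
  let eT : Γ →* FactorFam Γ Λ true := (MulEquiv.ulift (α := Γ)).symm.toMonoidHom
  let eF : Λ →* FactorFam Γ Λ false := (MulEquiv.ulift (α := Λ)).symm.toMonoidHom
  let dT : FactorFam Γ Λ true →* Γ := (MulEquiv.ulift (α := Γ)).toMonoidHom
  let dF : FactorFam Γ Λ false →* Λ := (MulEquiv.ulift (α := Λ)).toMonoidHom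
  let f : Coprod Γ Λ →* CoprodI (FactorFam Γ Λ) :=
    Coprod.lift (CoprodI.of.comp eT) (CoprodI.of.comp eF)
  let r : ∀ b, FactorFam Γ Λ b →* Coprod Γ Λ := fun b =>
    match b with
    | true => Coprod.inl.comp dT
    | false => Coprod.inr.comp dF
  let g : CoprodI (FactorFam Γ Λ) →* Coprod Γ Λ := CoprodI.lift r
  have hgf : g.comp f = MonoidHom.id _ := by
    apply Coprod.hom_ext
    · ext y
      simp only [MonoidHom.comp_apply, f, g, Coprod.lift_apply_inl, CoprodI.lift_of]
      rfl
    · ext y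
      simp only [MonoidHom.comp_apply, f, g, Coprod.lift_apply_inr, CoprodI.lift_of]
      rfl
  have hfa : ∀ y : Γ, f (Coprod.inl y) = CoprodI.of (eT y) := fun y => by
    simp only [f, Coprod.lift_apply_inl, MonoidHom.comp_apply]
  obtain ⟨c, hc⟩ := coprodI_malnormal true (f x) (eT a) (eT b)
    (fun h1 => ha (by
      have := congrArg dT h1
      exact this))
    (by rw [← hfa, ← hfa, ← map_mul, h, map_mul])
  refine ⟨dT c, ?_⟩
  have h2 : g (f x) = x := DFunLike.congr_fun hgf x
  rw [← h2, ← hc]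
  simp only [g, CoprodI.lift_of]
  rfl

/-- For the left translation action of the free product `G = Γ ∗ Λ` on the coset space
`G/K`, where `K` is the image of `Γ` under the canonical inclusion, the stabilizers of any
two distinct cosets intersect trivially; equivalently, for `η, η' ∈ G` with `ηK ≠ η'K` one
has `ηKη⁻¹ ∩ η'K(η')⁻¹ = {1}`. -/
theorem stmt_4 (Γ Λ : Type*) [Group Γ] [Group Λ]
    (K : Subgroup (Monoid.Coprod Γ Λ))
    (hK : K = (Monoid.Coprod.inl : Γ →* Monoid.Coprod Γ Λ).range) :
    (∀ c c' : Monoid.Coprod Γ Λ ⧸ K, c ≠ c' →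
      MulAction.stabilizer (Monoid.Coprod Γ Λ) c
        ⊓ MulAction.stabilizer (Monoid.Coprod Γ Λ) c' = ⊥) ∧
    ∀ η η' : Monoid.Coprod Γ Λ,
      (QuotientGroup.mk η : Monoid.Coprod Γ Λ ⧸ K) ≠ QuotientGroup.mk η' →
      Subgroup.map (MulAut.conj η).toMonoidHom K
        ⊓ Subgroup.map (MulAut.conj η').toMonoidHom K = ⊥ := by
  subst hK
  have key : ∀ η η' : Monoid.Coprod Γ Λ,
      (QuotientGroup.mk η : Monoid.Coprod Γ Λ ⧸ (Monoid.Coprod.inl : Γ →* Monoid.Coprod Γ Λ).range)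
        ≠ QuotientGroup.mk η' →
      Subgroup.map (MulAut.conj η).toMonoidHom (Monoid.Coprod.inl : Γ →* Monoid.Coprod Γ Λ).range
        ⊓ Subgroup.map (MulAut.conj η').toMonoidHom
          (Monoid.Coprod.inl : Γ →* Monoid.Coprod Γ Λ).range = ⊥ := by
    intro η η' hne
    rw [eq_bot_iff]
    rintro y ⟨⟨_, ⟨b, rfl⟩, hb⟩, ⟨_, ⟨a, rfl⟩, ha⟩⟩
    change η * Monoid.Coprod.inl b * η⁻¹ = y at hb
    change η' * Monoid.Coprod.inl a * η'⁻¹ = y at ha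
    rw [Subgroup.mem_bot]
    by_contra hy
    apply hne
    rw [QuotientGroup.eq]
    apply coprod_malnormal Γ Λ (η⁻¹ * η') a b
    · rintro rfl
      apply hy
      rw [← ha]
      simp
    · have h1 : Monoid.Coprod.inl b = η⁻¹ * y * η := by rw [← hb]; group
      have h2 : Monoid.Coprod.inl a = η'⁻¹ * y * η' := by rw [← ha]; group
      rw [h1, h2]
      group
  refine ⟨?_, key⟩
  intro c c' hne
  induction c using QuotientGroup.induction_on with | _ η
  induction c' using QuotientGroup.induction_on with | _ η'
  rw [← key η η' hne]
  have hs : ∀ ξ : Monoid.Coprod Γ Λ, MulAction.stabilizer (Monoid.Coprod Γ Λ)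
      (QuotientGroup.mk ξ : Monoid.Coprod Γ Λ ⧸ (Monoid.Coprod.inl : Γ →* Monoid.Coprod Γ Λ).range)
      = Subgroup.map (MulAut.conj ξ).toMonoidHom
          (Monoid.Coprod.inl : Γ →* Monoid.Coprod Γ Λ).range := by
    intro ξ
    ext y
    rw [MulAction.mem_stabilizer_iff]
    change (QuotientGroup.mk (y * ξ) : Monoid.Coprod Γ Λ ⧸ _) = _ ↔ _
    rw [eq_comm, QuotientGroup.eq]
    constructor
    · intro h
      refine ⟨_, h, ?_⟩
      change ξ * (ξ⁻¹ * (y * ξ)) * ξ⁻¹ = y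
      group
    · rintro ⟨k, hk, rfl⟩
      change ξ⁻¹ * (ξ * k * ξ⁻¹ * ξ) ∈ _
      have e : ξ⁻¹ * (ξ * k * ξ⁻¹ * ξ) = k := by group
      rw [e]
      exact hk
  rw [hs, hs]
end

section
/- Let X be a measurable space, e : X ≃ X a measurable equivalence, and let μ, ν be σ-finite measures on X such that μ ≪ ν, e_*μ ≪ μ, and e_*ν ≪ ν. Then ν-almost everywhere one has the identity (dμ/dν)(x) · (d(e_*μ)/dμ)(x) = (d(e_*ν)/dν)(x) · (dμ/dν)(e⁻¹ x). -/
open MeasureTheory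

/-- For a measurable equivalence `e` of a measurable space `X` and σ-finite measures with
`μ ≪ ν`, `e_*μ ≪ μ`, `e_*ν ≪ ν`, one has the ν-a.e. identity
`(dμ/dν)(x) · (d(e_*μ)/dμ)(x) = (d(e_*ν)/dν)(x) · (dμ/dν)(e⁻¹ x)`. -/
theorem stmt_11 (X : Type*) [MeasurableSpace X] (e : X ≃ᵐ X)
    (μ ν : Measure X) [SigmaFinite μ] [SigmaFinite ν]
    (hμν : μ ≪ ν) (heμ : μ.map e ≪ μ) (heν : ν.map e ≪ ν) :
    ∀ᵐ x ∂ν, μ.rnDeriv ν x * (μ.map e).rnDeriv μ x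
      = (ν.map e).rnDeriv ν x * μ.rnDeriv ν (e.symm x) := by
  have : SigmaFinite (μ.map e) := e.sigmaFinite_map
  have : SigmaFinite (ν.map e) := e.sigmaFinite_map
  have h1 := Measure.rnDeriv_mul_rnDeriv (κ := ν) heμ
  have h2 := Measure.rnDeriv_mul_rnDeriv (κ := ν) (hμν.map e.measurable)
  have h3 : ∀ᵐ x ∂(ν.map e), (μ.map e).rnDeriv (ν.map e) x = μ.rnDeriv ν (e.symm x) := by
    rw [e.measurableEmbedding.ae_map_iff]
    filter_upwards [e.measurableEmbedding.rnDeriv_map μ ν] with x hx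
    simpa using hx
  rw [← Measure.withDensity_rnDeriv_eq _ _ heν,
    ae_withDensity_iff (Measure.measurable_rnDeriv _ _),
    Measure.withDensity_rnDeriv_eq _ _ heν] at h3
  filter_upwards [h1, h2, h3] with x h1 h2 h3
  simp only [Pi.mul_apply] at h1 h2
  rw [mul_comm, h1, ← h2, mul_comm]
  by_cases h : (ν.map e).rnDeriv ν x = 0
  · simp [h]
  · rw [h3 h]
end

section
/- Let Γ be a countable group acting on a countable set X, let γ : ℕ → Γ be an enumeration of Γ with γ 0 = 1, let α : ℕ → ℝ be a summable sequence of strictly positive reals, let x : ℕ → X be a sequence, and let ω be an ultrafilter on ℕ. Let f : X → ℝ be bounded, and suppose L : ℕ → ℝ is such that for every i, f(γ i • x n) → L i along ω. Then along ω, the sequence n ↦ ∑_i α i · f(γ i • x n) · (∑_{j : γ j • x n = γ i • x n} α j) converges to ∑_i α i · L i · (∑_{j : {n | γ j • x n = γ i • x n} ∈ ω} α j). -/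
open Filter

/-- Computation of the weak limit along an ultrafilter `ω` of the states associated to the
vectors `ξ_n = ∑_i α_i δ_{γ_i • x_n}`: if `f (γ i • x n) → L i` along `ω` for every `i`,
then `∑_i α_i f(γ_i • x_n) (∑_{j : γ_j x_n = γ_i x_n} α_j)` converges along `ω` to
`∑_i α_i L_i (∑_{j : γ_j Λ = γ_i Λ} α_j)`, where `γ_j Λ = γ_i Λ` means
`{n | γ j • x n = γ i • x n} ∈ ω`. -/
theorem stmt_15 (Γ : Type*) [Group Γ] [Countable Γ] (X : Type*) [Countable X]
    [MulAction Γ X]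
    (γ : ℕ → Γ) (hγ : Function.Surjective γ) (hγ0 : γ 0 = 1)
    (α : ℕ → ℝ) (hα : Summable α) (hαpos : ∀ i, 0 < α i)
    (x : ℕ → X) (ω : Ultrafilter ℕ)
    (f : X → ℝ) (C : ℝ) (hf : ∀ y : X, |f y| ≤ C)
    (L : ℕ → ℝ)
    (hL : ∀ i, Tendsto (fun n => f (γ i • x n)) (ω : Filter ℕ) (nhds (L i))) :
    Tendsto
      (fun n => ∑' i : ℕ, α i * f (γ i • x n)
        * ∑' j : ℕ, Set.indicator {k | γ k • x n = γ i • x n} α j)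
      (ω : Filter ℕ)
      (nhds (∑' i : ℕ, α i * L i
        * ∑' j : ℕ, Set.indicator {k | {n | γ k • x n = γ i • x n} ∈ ω} α j)) := by
  have hind : ∀ (s : Set ℕ) (j : ℕ), ‖Set.indicator s α j‖ ≤ α j := by
    intro s j
    by_cases h : j ∈ s
    · rw [Set.indicator_of_mem h, Real.norm_eq_abs, abs_of_pos (hαpos j)]
    · rw [Set.indicator_of_notMem h, norm_zero]
      exact (hαpos j).le
  have hsum : ∀ s : Set ℕ, ‖∑' j : ℕ, Set.indicator s α j‖ ≤ ∑' j, α j := by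
    intro s
    exact tsum_of_norm_bounded hα.hasSum (hind s)
  have hC : 0 ≤ C := le_trans (abs_nonneg _) (hf (x 0))
  refine tendsto_tsum_of_dominated_convergence
    (bound := fun i => α i * C * ∑' j, α j) ((hα.mul_right C).mul_right _) ?_ ?_
  · intro i
    refine ((hL i).const_mul (α i)).mul ?_
    refine tendsto_tsum_of_dominated_convergence (bound := α) hα ?_ ?_
    · intro k
      by_cases h : {n | γ k • x n = γ i • x n} ∈ ω
      · refine tendsto_const_nhds.congr' ?_
        filter_upwards [show {n | γ k • x n = γ i • x n} ∈ (ω : Filter ℕ) from h] with n hn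
        rw [Set.indicator_of_mem (show k ∈ {k | {n | γ k • x n = γ i • x n} ∈ ω} from h),
          Set.indicator_of_mem (show k ∈ {k | γ k • x n = γ i • x n} from hn)]
      · refine tendsto_const_nhds.congr' ?_
        have h' := Ultrafilter.compl_mem_iff_notMem.mpr h
        filter_upwards [show {n | γ k • x n = γ i • x n}ᶜ ∈ (ω : Filter ℕ) from h'] with n hn
        rw [Set.indicator_of_notMem (show k ∉ {k | {n | γ k • x n = γ i • x n} ∈ ω} from h),
          Set.indicator_of_notMem (show k ∉ {k | γ k • x n = γ i • x n} from hn)]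
    · exact Eventually.of_forall fun n k => hind _ k
  · refine Eventually.of_forall fun n i => ?_
    rw [norm_mul, norm_mul, Real.norm_eq_abs (α i), abs_of_pos (hαpos i)]
    exact mul_le_mul (mul_le_mul_of_nonneg_left (hf _) (hαpos i).le) (hsum _) (norm_nonneg _)
      (mul_nonneg (hαpos i).le hC)
end

section
/- Let Γ be a countable group acting on a countable set X, let γ : ℕ → Γ be an enumeration of Γ with γ 0 = 1, let α : ℕ → ℝ be a summable sequence of strictly positive reals, let x : ℕ → X be a sequence, and let ω be an ultrafilter on ℕ. For each n define ξ_n ∈ ℓ²(X) by ξ_n(y) = ∑_{i : γ i • x n = y} α i (a well-defined element of ℓ²(X)). Then along ω, the squared norms ‖ξ_n‖²_{ℓ²(X)} converge to ∑_i α i · (∑_{j : {n | γ j • x n = γ i • x n} ∈ ω} α j). -/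
open Filter

theorem fiber_aux {X : Type*} (f : ℕ → X) (α : ℕ → ℝ) (hα : Summable α)
    (hpos : ∀ i, 0 < α i) :
    ∑' y : X, (∑' i : ℕ, Set.indicator {k | f k = y} α i) ^ 2
      = ∑' i : ℕ, α i * ∑' j : ℕ, Set.indicator {k | f k = f i} α j := by
  have hs : Summable (fun i => α i * ∑' j : ℕ, Set.indicator {k | f k = f i} α j) := by
    refine Summable.of_nonneg_of_le (fun i => mul_nonneg (hpos i).le
      (tsum_nonneg fun j => Set.indicator_nonneg (fun k _ => (hpos k).le) j)) (fun i => ?_)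
      (hα.mul_right (∑' j, α j))
    refine mul_le_mul_of_nonneg_left ?_ (hpos i).le
    exact (hα.indicator _).tsum_le_tsum
      (fun j => Set.indicator_le_self' (fun k _ => (hpos k).le) j) hα
  rw [← (hs.hasSum.tsum_fiberwise f).tsum_eq]
  refine tsum_congr fun y => ?_
  have h1 : ∀ b : f ⁻¹' {y}, α b * ∑' j : ℕ, Set.indicator {k | f k = f b} α j
      = α b * ∑' j : ℕ, Set.indicator {k | f k = y} α j := by
    rintro ⟨b, hb⟩
    have hb' : f b = y := hb
    simp only [hb']
  rw [tsum_congr h1, tsum_mul_right, tsum_subtype (f ⁻¹' {y}) α, sq]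
  rfl

/-- If `ξ_n ∈ ℓ²(X)` is defined by `ξ_n(y) = ∑_{i : γ i • x n = y} α i`, then along the
ultrafilter `ω` the squared norms `‖ξ_n‖²` converge to
`∑_i α_i (∑_{j : γ_j Λ = γ_i Λ} α_j)`, where `γ_j Λ = γ_i Λ` means
`{n | γ j • x n = γ i • x n} ∈ ω`. -/
theorem stmt_16 (Γ : Type*) [Group Γ] [Countable Γ] (X : Type*) [Countable X]
    [MulAction Γ X]
    (γ : ℕ → Γ) (hγ : Function.Surjective γ) (hγ0 : γ 0 = 1)
    (α : ℕ → ℝ) (hα : Summable α) (hαpos : ∀ i, 0 < α i)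
    (x : ℕ → X) (ω : Ultrafilter ℕ)
    (ξ : ℕ → lp (fun _ : X => ℝ) 2)
    (hξ : ∀ (n : ℕ) (y : X), ξ n y = ∑' i : ℕ, Set.indicator {k | γ k • x n = y} α i) :
    Tendsto (fun n => ‖ξ n‖ ^ 2) (ω : Filter ℕ)
      (nhds (∑' i : ℕ, α i
        * ∑' j : ℕ, Set.indicator {k | {n | γ k • x n = γ i • x n} ∈ ω} α j)) := by
  have hn : ∀ n, ‖ξ n‖ ^ 2 = ∑' i : ℕ, α i
      * ∑' j : ℕ, Set.indicator {k | γ k • x n = γ i • x n} α j := by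
    intro n
    rw [← fiber_aux (fun k => γ k • x n) α hα hαpos]
    have h := lp.norm_rpow_eq_tsum (p := 2) (by norm_num) (ξ n)
    simp only [ENNReal.toReal_ofNat, Real.rpow_ofNat, Real.norm_eq_abs, sq_abs] at h
    rw [h]
    exact tsum_congr fun y => by rw [hξ]
  simp only [hn]
  have hle : ∀ (s : Set ℕ) (j : ℕ), ‖s.indicator α j‖ ≤ α j := by
    intro s j
    rw [Real.norm_of_nonneg (Set.indicator_nonneg (fun k _ => (hαpos k).le) j)]
    exact Set.indicator_le_self' (fun k _ => (hαpos k).le) j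
  refine tendsto_tsum_of_dominated_convergence (hα.mul_right (∑' j, α j)) (fun i => ?_)
    (Eventually.of_forall fun n i => ?_)
  · refine Tendsto.const_mul _ ?_
    refine tendsto_tsum_of_dominated_convergence hα (fun j => ?_)
      (Eventually.of_forall fun n j => hle _ j)
    refine tendsto_const_nhds.congr' ?_
    by_cases h : {n | γ j • x n = γ i • x n} ∈ ω
    · have h' : ∀ᶠ n in (ω : Filter ℕ), γ j • x n = γ i • x n := h
      filter_upwards [h'] with n hn
      rw [Set.indicator_of_mem (by exact h), Set.indicator_of_mem (by exact hn)]
    · have h' : ∀ᶠ n in (ω : Filter ℕ), ¬ γ j • x n = γ i • x n :=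
        Ultrafilter.compl_mem_iff_notMem.mpr h
      filter_upwards [h'] with n hn
      rw [Set.indicator_of_notMem (by exact h), Set.indicator_of_notMem (by exact hn)]
  · rw [norm_mul, Real.norm_of_nonneg (hαpos i).le]
    refine mul_le_mul_of_nonneg_left ?_ (hαpos i).le
    exact tsum_of_norm_bounded hα.hasSum (hle _)
end
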